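/- Almost-sure existence of the target distribution in a stationary random environment: suppose there is a measurable set A ⊆ 𝒮_n with sup{δ(P) : P ∈ A} < 1 such that 𝐏-almost surely the coordinate P_k lies in A for infinitely many k ≥ 1. Then 𝐏-almost surely, for every t ∈ ℤ, δ(P^{s,t}) → 0 as s → −∞; in particular, 𝐏-almost surely the target distribution π_t exists for every t ∈ ℤ. -/

import Mathlib

open Filter MeasureTheory

/-- Borel-type measurable structure on `n × n` real matrices (entrywise). -/
instance (n : ℕ) : MeasurableSpace (Matrix (Fin n) (Fin n) ℝ) :=
  MeasurableSpace.pi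

/-- A row-stochastic `n × n` real matrix. -/
def IsStochastic (n : ℕ) (P : Matrix (Fin n) (Fin n) ℝ) : Prop :=
  (∀ x y, 0 ≤ P x y) ∧ ∀ x, ∑ y, P x y = 1

/-- Dobrushin ergodic coefficient. -/
noncomputable def dob (n : ℕ) (P : Matrix (Fin n) (Fin n) ℝ) : ℝ :=
  ⨆ x : Fin n, ⨆ y : Fin n, (1 / 2) * ∑ z, |P x z - P y z|

/-- The product `P^{s,t} = P_{s+1} ⋯ P_t` (identity when `s ≥ t`). -/
noncomputable def mprod (n : ℕ) (P : ℤ → Matrix (Fin n) (Fin n) ℝ) (s t : ℤ) :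
    Matrix (Fin n) (Fin n) ℝ :=
  ((List.range (t - s).toNat).map (fun i => P (s + 1 + i))).prod

/-- `π` is the family of target distributions for the sequence `P`. -/
def IsTarget (n : ℕ) (P : ℤ → Matrix (Fin n) (Fin n) ℝ) (π : ℤ → Fin n → ℝ) : Prop :=
  ∀ t : ℤ, (∀ y, 0 ≤ π t y) ∧ (∑ y, π t y = 1) ∧
    ∀ x y, Tendsto (fun s : ℤ => mprod n P s t x y) atBot (nhds (π t y))

namespace IsStochastic

variable {n : ℕ} {P Q : Matrix (Fin n) (Fin n) ℝ}

theorem one : IsStochastic n 1 := by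
  refine ⟨fun x y => ?_, fun x => ?_⟩
  · rw [Matrix.one_apply]
    split_ifs <;> norm_num
  · simp [Matrix.one_apply]

theorem mul (hP : IsStochastic n P) (hQ : IsStochastic n Q) : IsStochastic n (P * Q) := by
  refine ⟨fun x y => ?_, fun x => ?_⟩
  · rw [Matrix.mul_apply]
    exact Finset.sum_nonneg fun z _ => mul_nonneg (hP.1 x z) (hQ.1 z y)
  · simp only [Matrix.mul_apply]
    rw [Finset.sum_comm]
    simp only [← Finset.mul_sum, hQ.2, mul_one, hP.2]

end IsStochastic

theorem half_sum_abs_sub_le_dob {n : ℕ} (P : Matrix (Fin n) (Fin n) ℝ) (x y : Fin n) :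
    (1 / 2) * ∑ z, |P x z - P y z| ≤ dob n P :=
  (le_ciSup (f := fun y => (1 / 2) * ∑ z, |P x z - P y z|) (Set.finite_range _).bddAbove y).trans
    (le_ciSup (f := fun x => ⨆ y, (1 / 2) * ∑ z, |P x z - P y z|)
      (Set.finite_range _).bddAbove x)

theorem dob_le {n : ℕ} {P : Matrix (Fin n) (Fin n) ℝ} {c : ℝ} (hc : 0 ≤ c)
    (h : ∀ x y, ∑ z, |P x z - P y z| ≤ 2 * c) : dob n P ≤ c :=
  Real.iSup_le (fun x => Real.iSup_le (fun y => by linarith [h x y]) hc) hc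

theorem dob_nonneg {n : ℕ} (P : Matrix (Fin n) (Fin n) ℝ) : 0 ≤ dob n P :=
  Real.iSup_nonneg fun _ => Real.iSup_nonneg fun _ =>
    mul_nonneg (by norm_num) (Finset.sum_nonneg fun _ _ => abs_nonneg _)

theorem abs_sub_le_two_mul_dob {n : ℕ} (P : Matrix (Fin n) (Fin n) ℝ) (x x' y : Fin n) :
    |P x y - P x' y| ≤ 2 * dob n P := by
  have h := half_sum_abs_sub_le_dob P x x'
  have h' := Finset.single_le_sum (f := fun z => |P x z - P x' z|)
    (fun _ _ => abs_nonneg _) (Finset.mem_univ y)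
  linarith

theorem dob_le_one {n : ℕ} {P : Matrix (Fin n) (Fin n) ℝ} (hP : IsStochastic n P) :
    dob n P ≤ 1 := by
  refine dob_le zero_le_one fun x y => ?_
  calc ∑ z, |P x z - P y z| ≤ ∑ z, (P x z + P y z) :=
        Finset.sum_le_sum fun z _ => by
          rw [abs_le]
          constructor <;> linarith [hP.1 x z, hP.1 y z]
    _ = 2 * 1 := by rw [Finset.sum_add_distrib, hP.2, hP.2]; norm_num

/-- A matrix contracts zero-sum row vectors in `ℓ¹` by its Dobrushin coefficient. -/
theorem sum_abs_vecMul_le {n : ℕ} (Q : Matrix (Fin n) (Fin n) ℝ) (v : Fin n → ℝ)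
    (hv : ∑ i, v i = 0) :
    ∑ y, |∑ i, v i * Q i y| ≤ dob n Q * ∑ i, |v i| := by
  have hpos : ∑ i, (v i)⁺ = (∑ i, |v i|) / 2 := by
    have h1 : ∑ i, ((v i)⁺ - (v i)⁻) = 0 := by simpa [posPart_sub_negPart] using hv
    have h2 : ∑ i, |v i| = ∑ i, ((v i)⁺ + (v i)⁻) := by simp [posPart_add_negPart]
    rw [Finset.sum_sub_distrib] at h1
    rw [Finset.sum_add_distrib] at h2
    linarith
  have hneg : ∑ i, (v i)⁻ = (∑ i, |v i|) / 2 := by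
    have h2 : ∑ i, |v i| = ∑ i, ((v i)⁺ + (v i)⁻) := by simp [posPart_add_negPart]
    rw [Finset.sum_add_distrib] at h2
    linarith
  have hS : 0 ≤ ∑ i, |v i| := Finset.sum_nonneg fun _ _ => abs_nonneg _
  rcases hS.eq_or_lt with h0 | hlt
  · have hz : ∀ i, v i = 0 := fun i => by
      have := (Finset.sum_eq_zero_iff_of_nonneg (fun i _ => abs_nonneg (v i))).1 h0.symm i
        (Finset.mem_univ i)
      simpa using this
    simp [hz]
  set S := ∑ i, |v i| with hSdef
  have key : ∀ y, (S / 2) * ∑ i, v i * Q i y =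
      ∑ i, ∑ j, (v i)⁺ * (v j)⁻ * (Q i y - Q j y) := fun y => by
    have e1 : ∑ i, ∑ j, (v i)⁺ * (v j)⁻ * Q i y = (S / 2) * ∑ i, (v i)⁺ * Q i y := by
      rw [← hneg, Finset.sum_mul_sum, Finset.sum_comm]
      exact Finset.sum_congr rfl fun i _ => Finset.sum_congr rfl fun j _ => by ring
    have e2 : ∑ i, ∑ j, (v i)⁺ * (v j)⁻ * Q j y = (S / 2) * ∑ j, (v j)⁻ * Q j y := by
      rw [← hpos, Finset.sum_mul_sum]
      exact Finset.sum_congr rfl fun i _ => Finset.sum_congr rfl fun j _ => by ring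
    simp only [mul_sub, Finset.sum_sub_distrib]
    rw [e1, e2, ← mul_sub, ← Finset.sum_sub_distrib]
    congr 1
    refine Finset.sum_congr rfl fun i _ => ?_
    rw [← sub_mul, posPart_sub_negPart]
  have hw : ∀ i j, 0 ≤ (v i)⁺ * (v j)⁻ := fun i j =>
    mul_nonneg (posPart_nonneg _) (negPart_nonneg _)
  have main : (S / 2) * ∑ y, |∑ i, v i * Q i y| ≤ (S / 2) * (dob n Q * S) := by
    calc (S / 2) * ∑ y, |∑ i, v i * Q i y|
        = ∑ y, |∑ i, ∑ j, (v i)⁺ * (v j)⁻ * (Q i y - Q j y)| := by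
          rw [Finset.mul_sum]
          refine Finset.sum_congr rfl fun y _ => ?_
          rw [← key, abs_mul, abs_of_pos (half_pos hlt)]
      _ ≤ ∑ y, ∑ i, ∑ j, (v i)⁺ * (v j)⁻ * |Q i y - Q j y| := by
          refine Finset.sum_le_sum fun y _ => (Finset.abs_sum_le_sum_abs _ _).trans ?_
          refine Finset.sum_le_sum fun i _ => (Finset.abs_sum_le_sum_abs _ _).trans ?_
          refine Finset.sum_le_sum fun j _ => ?_
          rw [abs_mul, abs_of_nonneg (hw i j)]
      _ = ∑ i, ∑ j, (v i)⁺ * (v j)⁻ * ∑ y, |Q i y - Q j y| := by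
          rw [Finset.sum_comm]
          refine Finset.sum_congr rfl fun i _ => ?_
          rw [Finset.sum_comm]
          exact Finset.sum_congr rfl fun j _ => (Finset.mul_sum _ _ _).symm
      _ ≤ ∑ i, ∑ j, (v i)⁺ * (v j)⁻ * (2 * dob n Q) := by
          refine Finset.sum_le_sum fun i _ => Finset.sum_le_sum fun j _ => ?_
          refine mul_le_mul_of_nonneg_left ?_ (hw i j)
          linarith [half_sum_abs_sub_le_dob Q i j]
      _ = (S / 2) * (dob n Q * S) := by
          simp only [← Finset.sum_mul, ← Finset.mul_sum]
          rw [hpos, hneg]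
          ring
  exact le_of_mul_le_mul_left main (half_pos hlt)

theorem dob_mul_le {n : ℕ} {P : Matrix (Fin n) (Fin n) ℝ} (hP : IsStochastic n P)
    (Q : Matrix (Fin n) (Fin n) ℝ) : dob n (P * Q) ≤ dob n P * dob n Q := by
  refine dob_le (mul_nonneg (dob_nonneg P) (dob_nonneg Q)) fun x y => ?_
  have h := sum_abs_vecMul_le Q (fun i => P x i - P y i)
    (by rw [Finset.sum_sub_distrib, hP.2, hP.2, sub_self])
  simp only [sub_mul, Finset.sum_sub_distrib] at h
  simp only [Matrix.mul_apply]
  have h' := mul_le_mul_of_nonneg_left (half_sum_abs_sub_le_dob P x y) (dob_nonneg Q)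
  linarith

theorem mprod_eq_prod_map {n : ℕ} (P : ℤ → Matrix (Fin n) (Fin n) ℝ) (s t : ℤ) :
    mprod n P s t = ((List.range (t - s).toNat).map fun i : ℕ => P (s + 1 + i)).prod := by
  simp [mprod, ← List.map_eq_flatMap, Function.comp_def]

theorem mprod_of_le {n : ℕ} (P : ℤ → Matrix (Fin n) (Fin n) ℝ) {s t : ℤ} (h : t ≤ s) :
    mprod n P s t = 1 := by
  simp [mprod, Int.toNat_of_nonpos (sub_nonpos.2 h)]

theorem mprod_of_lt {n : ℕ} (P : ℤ → Matrix (Fin n) (Fin n) ℝ) {s t : ℤ} (h : s < t) :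
    mprod n P s t = P (s + 1) * mprod n P (s + 1) t := by
  have e : (t - s).toNat = (t - (s + 1)).toNat + 1 := by omega
  have hshift : (fun i : ℕ => P (s + 1 + ((i + 1 : ℕ) : ℤ))) = fun i : ℕ => P (s + 1 + 1 + i) :=
    funext fun i => congrArg P (by push_cast; ring)
  rw [mprod_eq_prod_map, mprod_eq_prod_map, e, List.range_succ_eq_map, List.map_cons,
    List.prod_cons, List.map_map, ← hshift]
  simp [Function.comp_def]

theorem exists_mprod_eq_mul {n : ℕ} {P : ℤ → Matrix (Fin n) (Fin n) ℝ}
    (hP : ∀ s, IsStochastic n (P s)) {s t : ℤ} (hst : s ≤ t) {r : ℤ} (hr : r ≤ s) :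
    ∃ Q, IsStochastic n Q ∧ mprod n P r t = Q * mprod n P s t := by
  induction r, hr using Int.leInductionDown with
  | base => exact ⟨1, IsStochastic.one, (one_mul _).symm⟩
  | pred r hr ih =>
    obtain ⟨Q, hQ, e⟩ := ih
    refine ⟨P r * Q, (hP r).mul hQ, ?_⟩
    rw [mprod_of_lt P (by omega), sub_add_cancel, e, mul_assoc]

theorem IsStochastic.mprod {n : ℕ} {P : ℤ → Matrix (Fin n) (Fin n) ℝ}
    (hP : ∀ s, IsStochastic n (P s)) (s t : ℤ) : IsStochastic n (mprod n P s t) := by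
  rcases le_total t s with h | h
  · rw [mprod_of_le P h]
    exact IsStochastic.one
  · obtain ⟨Q, hQ, e⟩ := exists_mprod_eq_mul hP le_rfl h
    rwa [e, mprod_of_le P le_rfl, mul_one]

theorem abs_mul_apply_sub_le {n : ℕ} {Q : Matrix (Fin n) (Fin n) ℝ} (hQ : IsStochastic n Q)
    (M : Matrix (Fin n) (Fin n) ℝ) (x x' y : Fin n) :
    |(Q * M) x y - M x' y| ≤ 2 * dob n M := by
  have e : (Q * M) x y - M x' y = ∑ z, Q x z * (M z y - M x' y) := by
    simp only [mul_sub, Finset.sum_sub_distrib, ← Finset.sum_mul, hQ.2, one_mul,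
      Matrix.mul_apply]
  rw [e]
  calc |∑ z, Q x z * (M z y - M x' y)| ≤ ∑ z, Q x z * (2 * dob n M) := by
        refine (Finset.abs_sum_le_sum_abs _ _).trans (Finset.sum_le_sum fun z _ => ?_)
        rw [abs_mul, abs_of_nonneg (hQ.1 x z)]
        exact mul_le_mul_of_nonneg_left (abs_sub_le_two_mul_dob M z x' y) (hQ.1 x z)
    _ = 2 * dob n M := by rw [← Finset.sum_mul, hQ.2, one_mul]

theorem dob_mprod_antitone {n : ℕ} {P : ℤ → Matrix (Fin n) (Fin n) ℝ}
    (hP : ∀ s, IsStochastic n (P s)) {r s t : ℤ} (hst : s ≤ t) (hr : r ≤ s) :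
    dob n (mprod n P r t) ≤ dob n (mprod n P s t) := by
  obtain ⟨Q, hQ, e⟩ := exists_mprod_eq_mul hP hst hr
  rw [e]
  exact (dob_mul_le hQ _).trans (mul_le_of_le_one_left (dob_nonneg _) (dob_le_one hQ))

theorem tendsto_dob_mprod {n : ℕ} {P : ℤ → Matrix (Fin n) (Fin n) ℝ}
    (hP : ∀ s, IsStochastic n (P s)) {c : ℝ} (hc : c < 1)
    (h : ∀ m : ℤ, ∃ k ≤ m, dob n (P k) ≤ c) (t : ℤ) :
    Tendsto (fun s : ℤ => dob n (mprod n P s t)) atBot (nhds 0) := by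
  have hc0 : 0 ≤ c := by
    obtain ⟨k, -, hk⟩ := h 0
    exact (dob_nonneg _).trans hk
  have key : ∀ N : ℕ, ∃ m ≤ t, dob n (mprod n P m t) ≤ c ^ N := fun N => by
    induction N with
    | zero => exact ⟨t, le_rfl, by simpa using dob_le_one (IsStochastic.mprod hP t t)⟩
    | succ N ih =>
      obtain ⟨m, hmt, hm⟩ := ih
      obtain ⟨k, hkm, hk⟩ := h m
      refine ⟨k - 1, by omega, ?_⟩
      rw [mprod_of_lt P (by omega), sub_add_cancel, pow_succ']
      exact (dob_mul_le (hP k) _).trans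
        (mul_le_mul hk ((dob_mprod_antitone hP hmt hkm).trans hm) (dob_nonneg _) hc0)
  rw [Metric.tendsto_nhds]
  intro ε hε
  obtain ⟨N, hN⟩ := exists_pow_lt_of_lt_one hε hc
  obtain ⟨m, hmt, hm⟩ := key N
  filter_upwards [eventually_le_atBot m] with s hs
  rw [Real.dist_eq, sub_zero, abs_of_nonneg (dob_nonneg _)]
  exact ((dob_mprod_antitone hP hmt hs).trans hm).trans_lt hN

theorem exists_isTarget {n : ℕ} (hn : 1 ≤ n) {P : ℤ → Matrix (Fin n) (Fin n) ℝ}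
    (hP : ∀ s, IsStochastic n (P s))
    (h : ∀ t : ℤ, Tendsto (fun s : ℤ => dob n (mprod n P s t)) atBot (nhds 0)) :
    ∃ π : ℤ → Fin n → ℝ, IsTarget n P π := by
  have hlim : ∀ (t : ℤ) (y : Fin n), ∃ p : ℝ, ∀ x,
      Tendsto (fun s : ℤ => mprod n P s t x y) atBot (nhds p) := by
    intro t y
    let x₀ : Fin n := ⟨0, hn⟩
    have hcau : Cauchy (map (fun s : ℤ => mprod n P s t x₀ y) atBot) := by
      rw [Metric.cauchy_iff]
      refine ⟨inferInstance, fun ε hε => ?_⟩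
      have hev := ((h t).eventually (gt_mem_nhds (show (0 : ℝ) < ε / 4 by positivity))).and
        (eventually_le_atBot t)
      obtain ⟨m, hm, hmt⟩ := hev.exists
      have hb : ∀ s ≤ m, |mprod n P s t x₀ y - mprod n P m t x₀ y| < ε / 2 := fun s hs => by
        obtain ⟨Q, hQ, e⟩ := exists_mprod_eq_mul hP hmt hs
        rw [e]
        exact (abs_mul_apply_sub_le hQ _ _ _ _).trans_lt (by linarith)
      refine ⟨_, image_mem_map (Iic_mem_atBot m), ?_⟩
      rintro _ ⟨r, hr, rfl⟩ _ ⟨s, hs, rfl⟩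
      have h1 := abs_lt.1 (hb r hr)
      have h2 := abs_lt.1 (hb s hs)
      rw [Real.dist_eq, abs_lt]
      constructor <;> linarith
    obtain ⟨p, hp⟩ := CompleteSpace.complete hcau
    refine ⟨p, fun x => ?_⟩
    have hz : Tendsto (fun s : ℤ => mprod n P s t x y - mprod n P s t x₀ y) atBot (nhds 0) :=
      squeeze_zero_norm (fun s => abs_sub_le_two_mul_dob _ x x₀ y)
        (by simpa using (h t).const_mul 2)
    simpa using hz.add (show Tendsto (fun s : ℤ => mprod n P s t x₀ y) atBot (nhds p) from hp)
  choose π hπ using hlim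
  refine ⟨π, fun t => ⟨fun y => ?_, ?_, fun x y => hπ t y x⟩⟩
  · exact ge_of_tendsto' (hπ t y ⟨0, hn⟩) fun s => (IsStochastic.mprod hP s t).1 _ _
  · refine tendsto_nhds_unique (tendsto_finsetSum Finset.univ fun y _ => hπ t y ⟨0, hn⟩) ?_
    simp only [(IsStochastic.mprod hP _ t).2]
    exact tendsto_const_nhds

/-- In a stationary two-sided sequence, a set that is almost surely visited at some time is
almost surely visited at arbitrarily negative times. -/
theorem ae_forall_exists_le_mem {α : Type*} [MeasurableSpace α] (μ : Measure (ℤ → α))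
    [IsProbabilityMeasure μ]
    (hshift : Measure.map (fun ω : ℤ → α => fun s => ω (s + 1)) μ = μ)
    {A : Set α} (hA : MeasurableSet A) (hex : ∀ᵐ ω ∂μ, ∃ k, ω k ∈ A) :
    ∀ᵐ ω ∂μ, ∀ m : ℤ, ∃ k ≤ m, ω k ∈ A := by
  let G : ℤ → Set (ℤ → α) := fun m => {ω | ∃ k ≤ m, ω k ∈ A}
  have hG : ∀ m, MeasurableSet (G m) := fun m => by
    have : G m = ⋃ k, ⋃ (_ : k ≤ m), (fun ω : ℤ → α => ω k) ⁻¹' A := by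
      ext ω
      simp [G]
    rw [this]
    exact MeasurableSet.iUnion fun k => MeasurableSet.iUnion fun _ => measurable_pi_apply k hA
  have hT : Measurable (fun ω : ℤ → α => fun s : ℤ => ω (s + 1)) :=
    measurable_pi_lambda _ fun s => measurable_pi_apply (s + 1)
  have hstep : ∀ m, μ (G (m + 1)) = μ (G m) := fun m => by
    conv_rhs => rw [← hshift, Measure.map_apply hT (hG m)]
    congr 1
    ext ω
    constructor
    · rintro ⟨k, hk, hkA⟩
      exact ⟨k - 1, by omega, by simpa using hkA⟩
    · rintro ⟨k, hk, hkA⟩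
      exact ⟨k + 1, by omega, hkA⟩
  have hconst : ∀ m, μ (G m) = μ (G 0) := fun m => by
    induction m using Int.induction_on with
    | zero => rfl
    | succ i ih => rw [hstep, ih]
    | pred i ih => rw [← ih, ← hstep, sub_add_cancel]
  have hmono : Monotone G := fun a b hab ω ⟨k, hk, hkA⟩ => ⟨k, hk.trans hab, hkA⟩
  have hunion : μ (⋃ m, G m) = μ (G 0) := by
    rw [hmono.measure_iUnion]
    simp [hconst]
  have hone : μ (⋃ m, G m) = 1 := by
    rw [← prob_compl_eq_zero_iff (MeasurableSet.iUnion hG)]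
    refine measure_mono_null (fun ω hω => ?_) (ae_iff.1 hex)
    rintro ⟨k, hk⟩
    exact hω (Set.mem_iUnion.2 ⟨k, k, le_rfl, hk⟩)
  rw [ae_all_iff]
  intro m
  have : μ (G m)ᶜ = 0 := by
    rw [prob_compl_eq_zero_iff (hG m), hconst, ← hunion, hone]
  exact ae_iff.2 this

/-- Almost-sure existence of the target distribution in a stationary random
environment (Proposition 4.1): if some measurable set `A` of matrices with
`sup{δ(P) : P ∈ A} < 1` is visited infinitely often among the coordinates `k ≥ 1`
almost surely, then almost surely `δ(P^{s,t}) → 0` as `s → −∞` for every `t`, and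
the target distributions exist. -/
theorem as_existence_target (n : ℕ) (hn : 1 ≤ n)
    (μ : Measure (ℤ → Matrix (Fin n) (Fin n) ℝ)) [IsProbabilityMeasure μ]
    (hstoch : ∀ᵐ ω ∂μ, ∀ s, IsStochastic n (ω s))
    (hshift : Measure.map (fun ω : ℤ → Matrix (Fin n) (Fin n) ℝ => fun s => ω (s + 1)) μ = μ)
    (A : Set (Matrix (Fin n) (Fin n) ℝ)) (hA : MeasurableSet A)
    (hAS : ∀ P ∈ A, IsStochastic n P)
    (c : ℝ) (hc : c < 1) (hAc : ∀ P ∈ A, dob n P ≤ c)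
    (hio : ∀ᵐ ω ∂μ, {k : ℤ | 1 ≤ k ∧ ω k ∈ A}.Infinite) :
    ∀ᵐ ω ∂μ,
      (∀ t : ℤ, Tendsto (fun s : ℤ => dob n (mprod n ω s t)) atBot (nhds 0)) ∧
      ∃ π : ℤ → Fin n → ℝ, IsTarget n ω π := by
  have hex : ∀ᵐ ω ∂μ, ∃ k, ω k ∈ A := by
    filter_upwards [hio] with ω hω
    obtain ⟨k, hk⟩ := hω.nonempty
    exact ⟨k, hk.2⟩
  filter_upwards [hstoch, ae_forall_exists_le_mem μ hshift hA hex] with ω hω hback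
  have hdob := tendsto_dob_mprod hω hc fun m =>
    (hback m).imp fun k hk => ⟨hk.1, hAc _ hk.2⟩
  exact ⟨hdob, exists_isTarget hn hω hdob⟩
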